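/- Let d ≥ 2, m := d − 2, and let J := {1,…,m} ⊔ {E₁,E₂,E₃,E₄} be a finite index set. Let b₁, b₂, b₃, b₄ be nonzero rational numbers, c₁, c₃ rational numbers, and a₁,…,a_m, e₁,…,e_m rational numbers. Let t : J × J → ℚ be a symmetric function satisfying: (i) t(E₁,E₂) = 0 and t(E₃,E₄) = 0; (ii) for every Z ∈ J, t(E₁,Z) = (b₁/b₂)·t(E₂,Z) + (c₁/b₄)·t(E₄,Z); (iii) for every Z ∈ J, t(E₃,Z) = (c₃/b₂)·t(E₂,Z) + (b₃/b₄)·t(E₄,Z); (iv) for every 1 ≤ i ≤ m and every Z ∈ J, t(i,Z) = (aᵢ/b₂)·t(E₂,Z) + (eᵢ/b₄)·t(E₄,Z). Set β := t(E₂,E₄). Then: b₁b₂b₃b₄·t(E₁,E₁) = (b₁²b₃c₁ − b₁c₁²c₃)β; b₁b₂b₃b₄·t(E₂,E₂) = −b₂²b₃c₁·β; b₁b₂b₃b₄·t(E₃,E₃) = (b₁b₃²c₃ − b₃c₁c₃²)β; b₁b₂b₃b₄·t(E₄,E₄) = −b₁b₄²c₃·β; b₁b₂b₃b₄·t(E₁,E₃)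 = (b₁²b₃² − b₁b₃c₁c₃)β; b₁b₂b₃b₄·t(E₁,E₄) = (b₁²b₃b₄ − b₁b₄c₁c₃)β; b₁b₂b₃b₄·t(E₂,E₃) = (b₁b₂b₃² − b₂b₃c₁c₃)β; for every 1 ≤ i ≤ m: b₁b₂b₃b₄·t(i,E₁) = (b₁²b₃eᵢ − b₁c₁c₃eᵢ)β, b₁b₂b₃b₄·t(i,E₂) = (b₁b₂b₃eᵢ − aᵢb₂b₃c₁)β, b₁b₂b₃b₄·t(i,E₃) = (aᵢb₁b₃² − aᵢb₃c₁c₃)β, b₁b₂b₃b₄·t(i,E₄) = (aᵢb₁b₃b₄ − b₁b₄c₃eᵢ)β; and for all 1 ≤ i, j ≤ m: b₁b₂b₃b₄·t(i,j) = (−aᵢaⱼb₃c₁ − eᵢeⱼb₁c₃ + aᵢeⱼb₁b₃ + aⱼeᵢb₁b₃)β. -/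

import Mathlib

/-- A symmetric form `t` in which `U` and `W` have coordinates `(p, q)` and `(p', q')` with respect to
`X / b₂` and `Y / b₄` is determined on `U, W` by `t X Y`, once the classes with coordinates
`(b₁, c₁)` and `(c₃, b₃)` are orthogonal to `X` and `Y` respectively. -/
theorem mul_apply_eq_of_coordinates {K J : Type*} [Field K] {b₁ b₂ b₃ b₄ c₁ c₃ : K}
    (hb₁ : b₁ ≠ 0) (hb₂ : b₂ ≠ 0) (hb₃ : b₃ ≠ 0) (hb₄ : b₄ ≠ 0)
    {t : J → J → K} (hsymm : ∀ Z W, t Z W = t W Z) {X Y : J}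
    (hX : b₁ / b₂ * t X X + c₁ / b₄ * t X Y = 0)
    (hY : c₃ / b₂ * t X Y + b₃ / b₄ * t Y Y = 0)
    {U W : J} {p q p' q' : K}
    (hU : ∀ Z, t U Z = p / b₂ * t X Z + q / b₄ * t Y Z)
    (hW : ∀ Z, t W Z = p' / b₂ * t X Z + q' / b₄ * t Y Z) :
    b₁ * b₂ * b₃ * b₄ * t U W =
      (-(p * p' * b₃ * c₁) - q * q' * b₁ * c₃ + p * q' * b₁ * b₃ + p' * q * b₁ * b₃) * t X Y := by
  have hXX : t X X = -(c₁ * b₂ / (b₁ * b₄)) * t X Y := by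
    field_simp at hX ⊢
    linear_combination hX
  have hYY : t Y Y = -(c₃ * b₄ / (b₂ * b₃)) * t X Y := by
    field_simp at hY ⊢
    linear_combination hY
  rw [hU, hsymm X W, hsymm Y W, hW, hW, hsymm Y X, hXX, hYY]
  field_simp
  ring

/-- The linear-algebraic heart of Proposition 3.6 of the paper: the intersection
numbers `t(Z,Z') = Z·Z'·S` on a torus invariant surface of Picard number `2`,
subject to the linear relations coming from the two ray relations of the fan,
are the stated explicit multiples of `β = t(E₂,E₄)`. The index set
`J = {1,…,m} ⊔ {E₁,E₂,E₃,E₄}` is `Fin (d-2) ⊕ Fin 4`, with `Eₖ = Sum.inr (k-1)`. -/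
theorem stmt_3 (d : ℕ) (hd : 2 ≤ d)
    (b₁ b₂ b₃ b₄ c₁ c₃ : ℚ)
    (hb₁ : b₁ ≠ 0) (hb₂ : b₂ ≠ 0) (hb₃ : b₃ ≠ 0) (hb₄ : b₄ ≠ 0)
    (a e : Fin (d - 2) → ℚ)
    (t : (Fin (d - 2) ⊕ Fin 4) → (Fin (d - 2) ⊕ Fin 4) → ℚ)
    (hsymm : ∀ Z W, t Z W = t W Z)
    (h12 : t (Sum.inr 0) (Sum.inr 1) = 0)
    (h34 : t (Sum.inr 2) (Sum.inr 3) = 0)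
    (hE1 : ∀ Z, t (Sum.inr 0) Z = (b₁ / b₂) * t (Sum.inr 1) Z + (c₁ / b₄) * t (Sum.inr 3) Z)
    (hE3 : ∀ Z, t (Sum.inr 2) Z = (c₃ / b₂) * t (Sum.inr 1) Z + (b₃ / b₄) * t (Sum.inr 3) Z)
    (hD : ∀ (i : Fin (d - 2)) (Z : Fin (d - 2) ⊕ Fin 4),
        t (Sum.inl i) Z = (a i / b₂) * t (Sum.inr 1) Z + (e i / b₄) * t (Sum.inr 3) Z) :
    let β := t (Sum.inr 1) (Sum.inr 3)
    b₁ * b₂ * b₃ * b₄ * t (Sum.inr 0) (Sum.inr 0)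
        = (b₁ ^ 2 * b₃ * c₁ - b₁ * c₁ ^ 2 * c₃) * β ∧
    b₁ * b₂ * b₃ * b₄ * t (Sum.inr 1) (Sum.inr 1) = -(b₂ ^ 2 * b₃ * c₁) * β ∧
    b₁ * b₂ * b₃ * b₄ * t (Sum.inr 2) (Sum.inr 2)
        = (b₁ * b₃ ^ 2 * c₃ - b₃ * c₁ * c₃ ^ 2) * β ∧
    b₁ * b₂ * b₃ * b₄ * t (Sum.inr 3) (Sum.inr 3) = -(b₁ * b₄ ^ 2 * c₃) * β ∧
    b₁ * b₂ * b₃ * b₄ * t (Sum.inr 0) (Sum.inr 2)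
        = (b₁ ^ 2 * b₃ ^ 2 - b₁ * b₃ * c₁ * c₃) * β ∧
    b₁ * b₂ * b₃ * b₄ * t (Sum.inr 0) (Sum.inr 3)
        = (b₁ ^ 2 * b₃ * b₄ - b₁ * b₄ * c₁ * c₃) * β ∧
    b₁ * b₂ * b₃ * b₄ * t (Sum.inr 1) (Sum.inr 2)
        = (b₁ * b₂ * b₃ ^ 2 - b₂ * b₃ * c₁ * c₃) * β ∧
    (∀ i : Fin (d - 2),
      b₁ * b₂ * b₃ * b₄ * t (Sum.inl i) (Sum.inr 0)
          = (b₁ ^ 2 * b₃ * e i - b₁ * c₁ * c₃ * e i) * β ∧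
      b₁ * b₂ * b₃ * b₄ * t (Sum.inl i) (Sum.inr 1)
          = (b₁ * b₂ * b₃ * e i - a i * b₂ * b₃ * c₁) * β ∧
      b₁ * b₂ * b₃ * b₄ * t (Sum.inl i) (Sum.inr 2)
          = (a i * b₁ * b₃ ^ 2 - a i * b₃ * c₁ * c₃) * β ∧
      b₁ * b₂ * b₃ * b₄ * t (Sum.inl i) (Sum.inr 3)
          = (a i * b₁ * b₃ * b₄ - b₁ * b₄ * c₃ * e i) * β) ∧
    (∀ i j : Fin (d - 2),
      b₁ * b₂ * b₃ * b₄ * t (Sum.inl i) (Sum.inl j)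
          = (-(a i * a j * b₃ * c₁) - e i * e j * b₁ * c₃
              + a i * e j * b₁ * b₃ + a j * e i * b₁ * b₃) * β) := by
  intro β
  have hX : b₁ / b₂ * t (Sum.inr 1) (Sum.inr 1) + c₁ / b₄ * t (Sum.inr 1) (Sum.inr 3) = 0 := by
    rw [hsymm (Sum.inr 1) (Sum.inr 3), ← hE1, h12]
  have hY : c₃ / b₂ * t (Sum.inr 1) (Sum.inr 3) + b₃ / b₄ * t (Sum.inr 3) (Sum.inr 3) = 0 := by
    rw [← hE3, h34]
  have hE2 : ∀ Z, t (Sum.inr 1) Z = b₂ / b₂ * t (Sum.inr 1) Z + 0 / b₄ * t (Sum.inr 3) Z := by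
    simp [hb₂]
  have hE4 : ∀ Z, t (Sum.inr 3) Z = 0 / b₂ * t (Sum.inr 1) Z + b₄ / b₄ * t (Sum.inr 3) Z := by
    simp [hb₄]
  have key {U W : Fin (d - 2) ⊕ Fin 4} {p q p' q' : ℚ}
      (hU : ∀ Z, t U Z = p / b₂ * t (Sum.inr 1) Z + q / b₄ * t (Sum.inr 3) Z)
      (hW : ∀ Z, t W Z = p' / b₂ * t (Sum.inr 1) Z + q' / b₄ * t (Sum.inr 3) Z) :=
    mul_apply_eq_of_coordinates hb₁ hb₂ hb₃ hb₄ hsymm hX hY hU hW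
  refine ⟨?_, ?_, ?_, ?_, ?_, ?_, ?_, fun i => ⟨?_, ?_, ?_, ?_⟩, fun i j => ?_⟩
  · linear_combination key hE1 hE1
  · linear_combination key hE2 hE2
  · linear_combination key hE3 hE3
  · linear_combination key hE4 hE4
  · linear_combination key hE1 hE3
  · linear_combination key hE1 hE4
  · linear_combination key hE2 hE3
  · linear_combination key (hD i) hE1
  · linear_combination key (hD i) hE2
  · linear_combination key (hD i) hE3
  · linear_combination key (hD i) hE4
  · exact key (hD i) (hD j)
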